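/- arXiv:2603.14735 — 2 statements merged into one kernel-verified Lean document; each statement's English description precedes it below -/
import Mathlib

section
/- Let (L, ∘_λ, ∗_λ) be a pre-Lie Poisson conformal algebra. Define [a_λ b] = a∗_λ b − b∗_{−∂−λ} a for all a, b ∈ L. Then (L, ∘_λ, [·_λ·]) is a transposed Poisson conformal algebra. -/
/-!
We model a `ℂ[∂]`-module as a complex vector space `L` together with an
endomorphism `D` (the action of `∂`).  A `λ`-product (or `λ`-bracket) is a
`ℂ`-bilinear map `L → L → L[λ]`, where the polynomial `x ∘_λ y = Σₙ λⁿ • cₙ`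
is encoded by its finitely supported family of coefficients `ℕ →₀ L`.
Substitution of the variable `λ` by a complex scalar, or by an operator such
as `-∂-λ`, is given by `ev`; since `ℂ` is infinite, an identity of
polynomials in (several) variables `λ, μ, γ` with coefficients in a complex
vector space holds formally if and only if it holds for all complex values
of the variables, which is how all identities are stated below.
-/

namespace ConfFormal

variable {L : Type*} [AddCommGroup L] [Module ℂ L]

/-- Evaluation of a polynomial `p = Σₙ λⁿ • pₙ` with coefficients in `L`
(encoded as the family of its coefficients) at an endomorphism `T` of `L`
(for instance at a scalar `λ`, or at an operator such as `-∂-λ`). -/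
noncomputable def ev (T : Module.End ℂ L) (p : ℕ →₀ L) : L :=
  p.sum fun n x => (T ^ n) x

/-- `app m T x y` is `x ∘_T y` : the `λ`-product `x ∘_λ y` recorded by the
`ℂ`-bilinear coefficient map `m`, with the variable `λ` substituted by the
endomorphism `T`. -/
noncomputable def app (m : L →ₗ[ℂ] L →ₗ[ℂ] (ℕ →₀ L)) (T : Module.End ℂ L) (x y : L) : L :=
  ev T (m x y)

/-- The scalar `c` viewed as an endomorphism of `L`. -/
noncomputable def sc (c : ℂ) : Module.End ℂ L := c • (1 : Module.End ℂ L)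

/-- `(L, D, m)` is a conformal algebra: conformal sesquilinearity holds. -/
structure IsConfAlg (D : Module.End ℂ L) (m : L →ₗ[ℂ] L →ₗ[ℂ] (ℕ →₀ L)) : Prop where
  sesq_left : ∀ (x y : L) (l : ℂ), app m (sc l) (D x) y = -l • app m (sc l) x y
  sesq_right : ∀ (x y : L) (l : ℂ),
    app m (sc l) x (D y) = D (app m (sc l) x y) + l • app m (sc l) x y

/-- `(L, D, m)` is a commutative associative conformal algebra. -/
structure IsCommAssocConfAlg (D : Module.End ℂ L) (m : L →ₗ[ℂ] L →ₗ[ℂ] (ℕ →₀ L))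
    extends IsConfAlg D m : Prop where
  assoc : ∀ (x y z : L) (l u : ℂ),
    app m (sc l) x (app m (sc u) y z) = app m (sc (l + u)) (app m (sc l) x y) z
  comm : ∀ (x y : L) (l : ℂ), app m (sc l) x y = app m (-(D + sc l)) y x

/-- `(L, D, br)` is a Lie conformal algebra. -/
structure IsLieConfAlg (D : Module.End ℂ L) (br : L →ₗ[ℂ] L →ₗ[ℂ] (ℕ →₀ L)) : Prop where
  sesq_left : ∀ (x y : L) (l : ℂ), app br (sc l) (D x) y = -l • app br (sc l) x y
  skew : ∀ (x y : L) (l : ℂ), app br (sc l) x y = -app br (-(sc l + D)) y x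
  jacobi : ∀ (x y z : L) (l u : ℂ),
    app br (sc l) x (app br (sc u) y z) =
      app br (sc (l + u)) (app br (sc l) x y) z + app br (sc u) y (app br (sc l) x z)

/-- `(L, D, m, br)` is a transposed Poisson conformal algebra. -/
structure IsTPCA (D : Module.End ℂ L) (m br : L →ₗ[ℂ] L →ₗ[ℂ] (ℕ →₀ L)) : Prop where
  commAssoc : IsCommAssocConfAlg D m
  lie : IsLieConfAlg D br
  tLeibniz : ∀ (x y z : L) (l u : ℂ),
    (2 : ℂ) • app m (sc l) x (app br (sc u) y z) =
      app br (sc (l + u)) (app m (sc l) x y) z + app br (sc u) y (app m (sc l) x z)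


/-- `(L, D, st)` is a left-symmetric (pre-Lie) conformal algebra. -/
structure IsLeftSymConfAlg (D : Module.End ℂ L) (st : L →ₗ[ℂ] L →ₗ[ℂ] (ℕ →₀ L))
    extends IsConfAlg D st : Prop where
  leftSym : ∀ (x y z : L) (l u : ℂ),
    app st (sc (l + u)) (app st (sc l) x y) z - app st (sc l) x (app st (sc u) y z)
      = app st (sc (l + u)) (app st (sc u) y x) z - app st (sc u) y (app st (sc l) x z)

/-- `(L, D, m, st)` is a pre-Lie Poisson conformal algebra. -/
structure IsPreLiePoissonConfAlg (D : Module.End ℂ L)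
    (m st : L →ₗ[ℂ] L →ₗ[ℂ] (ℕ →₀ L)) : Prop where
  commAssoc : IsCommAssocConfAlg D m
  leftSym : IsLeftSymConfAlg D st
  compat₁ : ∀ (x y z : L) (l u : ℂ),
    app st (sc (l + u)) (app m (sc l) x y) z = app m (sc l) x (app st (sc u) y z)
  compat₂ : ∀ (x y z : L) (l u : ℂ),
    app m (sc (l + u)) (app st (sc l) x y) z - app st (sc l) x (app m (sc u) y z)
      = app m (sc (l + u)) (app st (sc u) y x) z - app st (sc u) y (app m (sc l) x z)

@[simp] lemma sc_apply (c : ℂ) (x : L) : sc c x = c • x := by simp [sc]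

lemma sc_pow_apply (c : ℂ) (n : ℕ) (x : L) : (sc c ^ n) x = c ^ n • x := by
  simp [sc, smul_pow]

/-- `ev T` as a linear map. -/
noncomputable def evLin (T : Module.End ℂ L) : (ℕ →₀ L) →ₗ[ℂ] L :=
  Finsupp.lsum ℂ fun n => T ^ n

lemma evLin_apply (T : Module.End ℂ L) (p : ℕ →₀ L) : evLin T p = ev T p := rfl

/-- A polynomial with coefficients in `L` is determined by its values at complex numbers. -/
lemma eq_zero_of_ev_sc_eq_zero (p : ℕ →₀ L) (h : ∀ c : ℂ, ev (sc c) p = 0) : p = 0 := by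
  ext n
  refine (Module.forall_dual_apply_eq_zero_iff ℂ (p n)).1 fun f => ?_
  let q : Polynomial ℂ := p.sum fun k x => Polynomial.monomial k (f x)
  have hq : q = 0 := by
    refine Polynomial.funext fun c => ?_
    have hc := congrArg f (h c)
    simp only [ev, Finsupp.sum, map_sum, sc_pow_apply, map_smul, smul_eq_mul, map_zero] at hc
    simp only [q, Finsupp.sum, Polynomial.eval_finsetSum, Polynomial.eval_monomial,
      Polynomial.eval_zero]
    rw [← hc]
    exact Finset.sum_congr rfl fun k _ => mul_comm _ _
  have hn := congrArg (fun r => Polynomial.coeff r n) hq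
  by_cases hp : p n = 0
  · simp [hp]
  · simpa [q, Finsupp.sum, Polynomial.finsetSum_coeff, Polynomial.coeff_monomial, hp] using hn

/-- `F` is a polynomial function with values in `L`, and substituting the endomorphism `T`
for its variable gives `w`. -/
def SubstEq (T : Module.End ℂ L) (F : ℂ → L) (w : L) : Prop :=
  ∃ p : ℕ →₀ L, (∀ v, F v = ev (sc v) p) ∧ w = ev T p

namespace SubstEq

variable {T : Module.End ℂ L} {F G : ℂ → L} {w w' : L}

lemma unique (h : SubstEq T F w) (h' : SubstEq T F w') : w = w' := by
  obtain ⟨p, hp, rfl⟩ := h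
  obtain ⟨q, hq, rfl⟩ := h'
  have : p - q = 0 := eq_zero_of_ev_sc_eq_zero _ fun v => by
    rw [← evLin_apply, map_sub, evLin_apply, evLin_apply, ← hp, ← hq, sub_self]
  rw [sub_eq_zero.1 this]

lemma congr_fun (h : SubstEq T F w) (hF : ∀ v, F v = G v) : SubstEq T G w := by
  rwa [← funext hF]

lemma add (h : SubstEq T F w) (h' : SubstEq T G w') :
    SubstEq T (fun v => F v + G v) (w + w') := by
  obtain ⟨p, hp, rfl⟩ := h
  obtain ⟨q, hq, rfl⟩ := h'
  refine ⟨p + q, fun v => ?_, ?_⟩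
  · simp only [hp, hq]; exact (map_add (evLin (sc v)) p q).symm
  · exact (map_add (evLin T) p q).symm

lemma sub (h : SubstEq T F w) (h' : SubstEq T G w') :
    SubstEq T (fun v => F v - G v) (w - w') := by
  obtain ⟨p, hp, rfl⟩ := h
  obtain ⟨q, hq, rfl⟩ := h'
  refine ⟨p - q, fun v => ?_, ?_⟩
  · simp only [hp, hq]; exact (map_sub (evLin (sc v)) p q).symm
  · exact (map_sub (evLin T) p q).symm

lemma const (T : Module.End ℂ L) (x : L) : SubstEq T (fun _ => x) x :=
  ⟨Finsupp.single 0 x, fun v => by simp [ev], by simp [ev]⟩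

lemma sum {ι : Type*} (s : Finset ι) {F : ι → ℂ → L} {w : ι → L}
    (h : ∀ i ∈ s, SubstEq T (F i) (w i)) :
    SubstEq T (fun v => ∑ i ∈ s, F i v) (∑ i ∈ s, w i) := by
  classical
  induction s using Finset.induction_on with
  | empty => simpa using const T (0 : L)
  | insert i s hi ih =>
    simp only [Finset.sum_insert hi]
    exact (h i (Finset.mem_insert_self _ _)).add
      (ih fun j hj => h j (Finset.mem_insert_of_mem hj))

lemma monomial (T : Module.End ℂ L) (n : ℕ) (x : L) :
    SubstEq T (fun v => v ^ n • x) ((T ^ n) x) :=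
  ⟨Finsupp.single n x, fun v => by simp [ev, sc_pow_apply], by simp [ev]⟩

/-- Substitution commutes with linear maps that intertwine the substituted endomorphisms. -/
lemma map {T' : Module.End ℂ L} (h : SubstEq T F w) (S : L →ₗ[ℂ] L)
    (hS : ∀ x, S (T x) = T' (S x)) : SubstEq T' (fun v => S (F v)) (S w) := by
  obtain ⟨p, hp, rfl⟩ := h
  have hpow : ∀ (n : ℕ) (x : L), S ((T ^ n) x) = (T' ^ n) (S x) := by
    intro n
    induction n with
    | zero => simp
    | succ n ih => intro x; simp [pow_succ, ih, hS]
  have h := sum p.support fun n _ => monomial T' n (S (p n))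
  simp only [← hpow, ← map_smul, ← map_sum] at h
  refine h.congr_fun fun v => ?_
  simp [hp, ev, Finsupp.sum, sc_pow_apply]

lemma smul_var (h : SubstEq T F w) : SubstEq T (fun v => v • F v) (T w) := by
  obtain ⟨p, hp, rfl⟩ := h
  have h := sum p.support fun n _ => monomial T (n + 1) (p n)
  simp only [pow_succ', Module.End.mul_apply, ← map_sum, mul_smul, ← Finset.smul_sum] at h
  refine h.congr_fun fun v => ?_
  simp [hp, ev, Finsupp.sum, sc_pow_apply]

/-- Iterating an operation that is compatible with substitution. -/
lemma iterate {A : Module.End ℂ L} {B : ℂ → Module.End ℂ L}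
    (hAB : ∀ {F : ℂ → L} {w : L}, SubstEq T F w → SubstEq T (fun v => B v (F v)) (A w))
    (h : SubstEq T F w) (n : ℕ) : SubstEq T (fun v => (B v ^ n) (F v)) ((A ^ n) w) := by
  induction n with
  | zero => simpa using h
  | succ n ih => simpa [pow_succ'] using hAB ih

lemma ev_of {A : Module.End ℂ L} {B : ℂ → Module.End ℂ L}
    (hAB : ∀ {F : ℂ → L} {w : L}, SubstEq T F w → SubstEq T (fun v => B v (F v)) (A w))
    {G : L → ℂ → L} {W : L → L} (p : ℕ →₀ L) (h : ∀ x, SubstEq T (G x) (W x)) :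
    SubstEq T (fun v => p.sum fun n x => (B v ^ n) (G x v)) (p.sum fun n x => (A ^ n) (W x)) :=
  sum p.support fun n _ => iterate hAB (h (p n)) n

lemma ev_shift (T : Module.End ℂ L) (u : ℂ) (p : ℕ →₀ L) :
    SubstEq T (fun v => ev (sc (v + u)) p) (ev (T + sc u) p) := by
  refine ev_of (fun {F w} h => ?_) p fun x => const T x
  refine ((h.smul_var).add (h.map (sc u) fun x => by simp)).congr_fun fun v => ?_
  simp [add_smul]

lemma ev_var (T : Module.End ℂ L) (p : ℕ →₀ L) :
    SubstEq T (fun v => ev (sc v) p) (ev T p) :=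
  ⟨p, fun _ => rfl, rfl⟩

lemma app_var (m : L →ₗ[ℂ] L →ₗ[ℂ] (ℕ →₀ L)) (T : Module.End ℂ L) (x y : L) :
    SubstEq T (fun v => app m (sc v) x y) (app m T x y) :=
  ev_var T _

lemma app_shift (m : L →ₗ[ℂ] L →ₗ[ℂ] (ℕ →₀ L)) {T R : Module.End ℂ L} {u : ℂ}
    (hR : R = T + sc u) (x y : L) :
    SubstEq T (fun v => app m (sc (v + u)) x y) (app m R x y) :=
  hR ▸ ev_shift T u _

end SubstEq

/-- A linear map intertwining two endomorphisms commutes with evaluation. -/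
lemma map_ev {T T' : Module.End ℂ L} (S : L →ₗ[ℂ] L) (hS : ∀ x, S (T x) = T' (S x))
    (p : ℕ →₀ L) : S (ev T p) = p.sum fun n x => (T' ^ n) (S x) :=
  ((SubstEq.ev_var T p).map S hS).unique <|
    (SubstEq.sum p.support fun n _ => SubstEq.monomial T' n (S (p n))).congr_fun fun v => by
      simp [ev, Finsupp.sum, sc_pow_apply]

/-- The map `y ↦ x ∘_T y`. -/
noncomputable def appRight (m : L →ₗ[ℂ] L →ₗ[ℂ] (ℕ →₀ L)) (T : Module.End ℂ L) (x : L) :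
    L →ₗ[ℂ] L := evLin T ∘ₗ m x

/-- The map `x ↦ x ∘_T y`. -/
noncomputable def appLeft (m : L →ₗ[ℂ] L →ₗ[ℂ] (ℕ →₀ L)) (T : Module.End ℂ L) (y : L) :
    L →ₗ[ℂ] L := evLin T ∘ₗ m.flip y

lemma appRight_apply (m : L →ₗ[ℂ] L →ₗ[ℂ] (ℕ →₀ L)) (T : Module.End ℂ L) (x y : L) :
    appRight m T x y = app m T x y := rfl

lemma appLeft_apply (m : L →ₗ[ℂ] L →ₗ[ℂ] (ℕ →₀ L)) (T : Module.End ℂ L) (x y : L) :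
    appLeft m T y x = app m T x y := rfl

section Products

variable {D : Module.End ℂ L} {m n : L →ₗ[ℂ] L →ₗ[ℂ] (ℕ →₀ L)}

lemma app_sub_right (T : Module.End ℂ L) (x y z : L) :
    app m T x (y - z) = app m T x y - app m T x z :=
  map_sub (appRight m T x) y z

lemma app_sub_left (T : Module.End ℂ L) (x y z : L) :
    app m T (x - y) z = app m T x z - app m T y z :=
  map_sub (appLeft m T z) x y

lemma IsConfAlg.app_left (hm : IsConfAlg D m) (T : Module.End ℂ L) (x y : L) :
    app m T (D x) y = -T (app m T x y) := by
  refine (SubstEq.app_var m T (D x) y).unique ?_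
  have h := (SubstEq.const T (0 : L)).sub (SubstEq.app_var m T x y).smul_var
  rw [zero_sub] at h
  exact h.congr_fun fun v => by simp [hm.sesq_left]

lemma IsConfAlg.app_right (hm : IsConfAlg D m) {T : Module.End ℂ L}
    (hT : ∀ x, D (T x) = T (D x)) (x y : L) :
    app m T x (D y) = D (app m T x y) + T (app m T x y) := by
  refine (SubstEq.app_var m T x (D y)).unique ?_
  have h := SubstEq.app_var m T x y
  exact ((h.map D hT).add h.smul_var).congr_fun fun v => (hm.sesq_right x y v).symm

/-- `(x ∘_{-∂-l} y) ∘_{l+u} z = (x ∘_u y) ∘_{l+u} z`. -/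
lemma IsConfAlg.app_app_left (hn : IsConfAlg D n) (l u : ℂ) (x y z : L) :
    app n (sc (l + u)) (app m (-(D + sc l)) x y) z = app n (sc (l + u)) (app m (sc u) x y) z := by
  have h1 := map_ev (T := -(D + sc l)) (T' := sc u) (appLeft n (sc (l + u)) z)
    (fun a => by
      simp only [LinearMap.neg_apply, LinearMap.add_apply, map_neg, map_add, appLeft_apply,
        hn.app_left, sc_apply, map_smul]
      module) (m x y)
  have h2 := map_ev (T := sc u) (T' := sc u) (appLeft n (sc (l + u)) z)
    (fun a => by simp) (m x y)
  exact h1.trans h2.symm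

/-- `x ∘_{-∂-l-u} (y ∘_{-∂-l} z) = x ∘_{-∂-l-u} (y ∘_u z)`. -/
lemma IsConfAlg.app_app_right (hn : IsConfAlg D n) (l u : ℂ) (x y z : L) :
    app n (-(D + sc (l + u))) x (app m (-(D + sc l)) y z) =
      app n (-(D + sc (l + u))) x (app m (sc u) y z) := by
  have h1 := map_ev (T := -(D + sc l)) (T' := sc u) (appRight n (-(D + sc (l + u))) x)
    (fun a => by
      simp only [LinearMap.neg_apply, LinearMap.add_apply, map_neg, map_add, appRight_apply,
        sc_apply, map_smul]
      rw [hn.app_right (by simp)]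
      simp only [LinearMap.neg_apply, LinearMap.add_apply, sc_apply]
      module) (m y z)
  have h2 := map_ev (T := sc u) (T' := sc u) (appRight n (-(D + sc (l + u))) x)
    (fun a => by simp) (m y z)
  exact h1.trans h2.symm

/-- Substituting `v = -∂-l-u` in `y ∘_u (z ∘_v x)`. -/
lemma IsConfAlg.substEq_app_right (hn : IsConfAlg D n) (l u : ℂ) (x y z : L) :
    SubstEq (-(D + sc (l + u))) (fun v => app n (sc u) y (app m (sc v) z x))
      (app n (sc u) y (app m (-(D + sc l)) z x)) := by
  refine (SubstEq.app_var m (-(D + sc l)) z x).map (appRight n (sc u) y) fun a => ?_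
  simp only [LinearMap.neg_apply, LinearMap.add_apply, map_neg, map_add, appRight_apply,
    hn.sesq_right, sc_apply, map_smul]
  module

/-- Substituting `v = -∂-l-u` in `(z ∘_v y) ∘_{v+u} x`. -/
lemma IsConfAlg.substEq_app_left (hn : IsConfAlg D n) (l u : ℂ) (x y z : L) :
    SubstEq (-(D + sc (l + u))) (fun v => app n (sc (v + u)) (app m (sc v) z y) x)
      (app n (-(D + sc l)) (app m (-(D + sc u)) z y) x) := by
  have h1 := map_ev (T := -(D + sc u)) (T' := -(D + sc (l + u))) (appLeft n (-(D + sc l)) x)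
    (fun a => by
      simp only [LinearMap.neg_apply, LinearMap.add_apply, map_neg, map_add, appLeft_apply,
        hn.app_left, sc_apply, map_smul]
      module) (m z y)
  have h2 := SubstEq.ev_of (T := -(D + sc (l + u))) (A := -(D + sc (l + u))) (B := sc)
    (G := fun a v => app n (sc (v + u)) a x) (W := fun a => app n (-(D + sc l)) a x)
    (fun h => by simpa only [sc_apply] using h.smul_var) (m z y)
    (fun a => SubstEq.app_shift n (by ext; simp; module) a x)
  change SubstEq _ _ (appLeft n (-(D + sc l)) x (ev (-(D + sc u)) (m z y)))
  rw [h1]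
  exact h2.congr_fun fun v =>
    (map_ev (T := sc v) (T' := sc v) (appLeft n (sc (v + u)) x) (fun a => by simp) (m z y)).symm

lemma substEq_app_outer (l u : ℂ) (x y : L) :
    SubstEq (-(D + sc (l + u))) (fun v => app n (sc (v + u)) x y) (app n (-(D + sc l)) x y) :=
  SubstEq.app_shift n (by ext; simp; module) x y

/-- A left-symmetry relation between two products, with `-∂-l-u` substituted for one of the
variables. -/
lemma leftSym_subst (hm : IsConfAlg D m) (hn : IsConfAlg D n)
    (h : ∀ (x y z : L) (l u : ℂ),
      app m (sc (l + u)) (app n (sc l) x y) z - app n (sc l) x (app m (sc u) y z)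
        = app m (sc (l + u)) (app n (sc u) y x) z - app n (sc u) y (app m (sc l) x z))
    (x y z : L) (l u : ℂ) :
    app m (-(D + sc l)) (app n (-(D + sc u)) z y) x
        - app n (-(D + sc (l + u))) z (app m (sc u) y x)
      = app m (-(D + sc l)) (app n (sc u) y z) x
        - app n (sc u) y (app m (-(D + sc l)) z x) :=
  ((hm.substEq_app_left l u x y z).sub (SubstEq.app_var n _ z _)).unique <|
    ((substEq_app_outer l u _ x).sub (hn.substEq_app_right l u x y z)).congr_fun fun v =>
      (h z y x v u).symm

/-- Swapping twice: substituting `v = -∂-l` in `x ∘_{-∂-v} y` gives `x ∘_l y`. -/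
lemma substEq_app_swap (l : ℂ) (x y : L) :
    SubstEq (-(D + sc l)) (fun v => app n (-(D + sc v)) x y) (app n (sc l) x y) := by
  refine SubstEq.ev_of (fun {F w} h => ?_) (n x y) fun a => SubstEq.const _ a
  have hA : sc l w = (-D) w - (-(D + sc l) : Module.End ℂ L) w := by
    simp
  rw [hA]
  refine ((h.map (T' := -(D + sc l)) (-D) fun a => by simp [add_comm]).sub h.smul_var).congr_fun
    fun v => ?_
  simp only [LinearMap.neg_apply, LinearMap.add_apply, sc_apply]
  module

end Products

/-- The commutator of a left-symmetric conformal algebra is a Lie conformal algebra. -/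
lemma IsLeftSymConfAlg.isLieConfAlg {D : Module.End ℂ L} {st br : L →ₗ[ℂ] L →ₗ[ℂ] (ℕ →₀ L)}
    (hst : IsLeftSymConfAlg D st)
    (hbr : ∀ (a b : L) (l : ℂ),
      app br (sc l) a b = app st (sc l) a b - app st (-(D + sc l)) b a) :
    IsLieConfAlg D br where
  sesq_left x y l := by
    rw [hbr, hbr, hst.sesq_left, hst.app_right (by simp)]
    simp only [LinearMap.neg_apply, LinearMap.add_apply, sc_apply]
    module
  skew x y l := by
    have h := (SubstEq.app_var br (-(D + sc l)) y x).unique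
      (((SubstEq.app_var st _ y x).sub (substEq_app_swap l x y)).congr_fun fun v =>
        (hbr y x v).symm)
    rw [add_comm (sc l) D, h, hbr, neg_sub]
  jacobi x y z l u := by
    have h1 := leftSym_subst hst.toIsConfAlg hst.toIsConfAlg hst.leftSym x y z l u
    have h2 := leftSym_subst hst.toIsConfAlg hst.toIsConfAlg hst.leftSym y x z u l
    have h3 := hst.leftSym x y z l u
    rw [add_comm u l] at h2
    simp only [hbr, app_sub_left, app_sub_right, hst.app_app_left, hst.app_app_right]
    linear_combination (norm := module) h1 - h2 - h3

/-- The commutator bracket `[a_λ b] = a∗_λ b − b∗_{−∂−λ} a`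
of a pre-Lie Poisson conformal algebra makes it a transposed Poisson
conformal algebra. -/
theorem preLiePoisson_tpca {L : Type*} [AddCommGroup L] [Module ℂ L]
    (D : Module.End ℂ L) (m st : L →ₗ[ℂ] L →ₗ[ℂ] (ℕ →₀ L))
    (hPLP : IsPreLiePoissonConfAlg D m st)
    (br : L →ₗ[ℂ] L →ₗ[ℂ] (ℕ →₀ L))
    (hbr : ∀ (a b : L) (l : ℂ),
      app br (sc l) a b = app st (sc l) a b - app st (-(D + sc l)) b a) :
    IsTPCA D m br := by
  have hm := hPLP.commAssoc
  have hst := hPLP.leftSym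
  refine ⟨hm, hst.isLieConfAlg hbr, fun x y z l u => ?_⟩
  have h1 := hPLP.compat₁ x y z l u
  have h2 : app st (-(D + sc u)) (app m (sc l) x z) y =
      app m (sc l) x (app st (-(D + sc u)) z y) := by
    refine ((substEq_app_outer u l _ y).congr_fun fun v => ?_).unique
      (hm.substEq_app_right u l y x z)
    rw [add_comm v l, hPLP.compat₁]
  have h3 := leftSym_subst hm.toIsConfAlg hst.toIsConfAlg hPLP.compat₂ x y z l u
  rw [← hst.app_app_right, ← hm.comm, ← hm.comm, ← hm.comm, ← hm.comm] at h3
  simp only [hbr, app_sub_right, h1, h2]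
  linear_combination (norm := module) -h3

end ConfFormal
end

section
/- Let Vir = ℂ[∂]L be the Virasoro Lie conformal algebra, the free ℂ[∂]-module on one generator L with λ-bracket [L_λ L] = (∂+2λ)L (extended by conformal sesquilinearity). A ℂ-bilinear λ-product ∘_λ on Vir makes (Vir, ∘_λ, [·_λ·]) a transposed Poisson conformal algebra if and only if there exists a constant c ∈ ℂ such that L∘_λ L = cL (and ∘_λ is extended by conformal sesquilinearity). -/
/-!
We model a `ℂ[∂]`-module as a complex vector space `L` together with an
endomorphism `D` (the action of `∂`).  A `λ`-product (or `λ`-bracket) is a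
`ℂ`-bilinear map `L → L → L[λ]`, where the polynomial `x ∘_λ y = Σₙ λⁿ • cₙ`
is encoded by its finitely supported family of coefficients `ℕ →₀ L`.
Substitution of the variable `λ` by a complex scalar, or by an operator such
as `-∂-λ`, is given by `ev`; since `ℂ` is infinite, an identity of
polynomials in (several) variables `λ, μ, γ` with coefficients in a complex
vector space holds formally if and only if it holds for all complex values
of the variables, which is how all identities are stated below.
-/

namespace ConfFormal

variable {L : Type*} [AddCommGroup L] [Module ℂ L]

open Polynomial in
/-- Evaluating at `x` a substitution of the operator of multiplication by `t` amounts to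
substituting the scalar `t(x)`. -/
lemma eval_ev_of_mul (T : Module.End ℂ ℂ[X]) (t : ℂ[X]) (hT : ∀ f, T f = t * f)
    (p : ℕ →₀ ℂ[X]) (x : ℂ) : (ev T p).eval x = (ev (sc (t.eval x)) p).eval x := by
  have hpow : ∀ (n : ℕ) (f : ℂ[X]), (T ^ n) f = t ^ n * f := by
    intro n
    induction n with
    | zero => simp
    | succ k ih => intro f; rw [pow_succ, Module.End.mul_apply, ih, hT]; ring
  simp only [ev, sc, Finsupp.sum, eval_finsetSum, hpow, _root_.smul_pow, one_pow]
  simp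

lemma app_add_left (m : L →ₗ[ℂ] L →ₗ[ℂ] (ℕ →₀ L)) (T : Module.End ℂ L) (x y z : L) :
    app m T (x + y) z = app m T x z + app m T y z := by
  simp only [app, ev, map_add, LinearMap.add_apply]
  exact Finsupp.sum_add_index' (by simp) (by simp)

lemma app_add_right (m : L →ₗ[ℂ] L →ₗ[ℂ] (ℕ →₀ L)) (T : Module.End ℂ L) (x y z : L) :
    app m T x (y + z) = app m T x y + app m T x z := by
  simp only [app, ev, map_add]
  exact Finsupp.sum_add_index' (by simp) (by simp)

lemma app_smul_left (m : L →ₗ[ℂ] L →ₗ[ℂ] (ℕ →₀ L)) (T : Module.End ℂ L) (c : ℂ) (x y : L) :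
    app m T (c • x) y = c • app m T x y := by
  simp only [app, ev, map_smul, LinearMap.smul_apply]
  rw [Finsupp.sum_smul_index' (by simp), Finsupp.smul_sum]
  simp

lemma app_smul_right (m : L →ₗ[ℂ] L →ₗ[ℂ] (ℕ →₀ L)) (T : Module.End ℂ L) (c : ℂ) (x y : L) :
    app m T x (c • y) = c • app m T x y := by
  simp only [app, ev, map_smul]
  rw [Finsupp.sum_smul_index' (by simp), Finsupp.smul_sum]
  simp

open Polynomial in
/-- Substituting `-∂-λ` and then evaluating at `∂ = x`. -/
lemma eval_app_neg_add (D : Module.End ℂ ℂ[X]) (hD : ∀ f, D f = X * f)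
    (m : ℂ[X] →ₗ[ℂ] ℂ[X] →ₗ[ℂ] (ℕ →₀ ℂ[X])) (f g : ℂ[X]) (l x : ℂ) :
    (app m (-(D + sc l)) f g).eval x = (app m (sc (-(x + l))) f g).eval x := by
  have h := eval_ev_of_mul (-(D + sc l)) (-(X + C l))
    (fun f => by simp [hD, sc, smul_eq_C_mul]; ring) (m f g) x
  simpa [app] using h

open Polynomial in
/-- A polynomial invariant under a contraction `x₀ + t ↦ x₀ + t / 2` is constant. -/
lemma eval_eq_of_halving (q : ℂ[X]) (x₀ : ℂ)
    (h : ∀ t, q.eval (x₀ + t) = q.eval (x₀ + t / 2)) (x : ℂ) : q.eval x = q.eval x₀ := by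
  have hn : ∀ (n : ℕ) (t : ℂ), q.eval (x₀ + t) = q.eval (x₀ + t * (1 / 2) ^ n) := by
    intro n
    induction n with
    | zero => simp
    | succ k ih => intro t; rw [ih, h]; congr 2; ring
  have hlim : Filter.Tendsto (fun n : ℕ => q.eval (x₀ + (x - x₀) * (1 / 2) ^ n)) Filter.atTop
      (nhds (q.eval (x₀ + (x - x₀) * 0))) := by
    refine (q.continuous.tendsto _).comp ?_
    refine tendsto_const_nhds.add (tendsto_const_nhds.mul ?_)
    exact tendsto_pow_atTop_nhds_zero_of_norm_lt_one (by norm_num)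
  have hconst : ∀ n : ℕ, q.eval (x₀ + (x - x₀) * (1 / 2) ^ n) = q.eval x := by
    intro n
    rw [← hn n]; congr 1; ring
  simp only [hconst, mul_zero, add_zero] at hlim
  exact tendsto_nhds_unique tendsto_const_nhds hlim

open Polynomial in
/-- A product on `ℂ[∂]L` is determined by sesquilinearity from `L ∘_λ L`. -/
lemma IsConfAlg.app_eq (D : Module.End ℂ ℂ[X]) (hD : ∀ f, D f = X * f)
    (m : ℂ[X] →ₗ[ℂ] ℂ[X] →ₗ[ℂ] (ℕ →₀ ℂ[X])) (hm : IsConfAlg D m) (f g : ℂ[X]) (l : ℂ) :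
    app m (sc l) f g = f.eval (-l) • (g.comp (X + C l) * app m (sc l) 1 1) := by
  have key : ∀ (n k : ℕ), app m (sc l) (X ^ n) (X ^ k)
      = (-l) ^ n • ((X + C l) ^ k * app m (sc l) 1 1) := by
    intro n k
    induction n with
    | zero =>
      induction k with
      | zero => simp
      | succ k ih =>
        rw [pow_succ', ← hD, hm.sesq_right, ih, hD]
        simp only [smul_eq_C_mul, pow_zero, C_1]
        ring
    | succ n ih =>
      rw [pow_succ', ← hD, hm.sesq_left, ih, smul_smul, ← pow_succ']
  induction f using Polynomial.induction_on' with
  | add p q hp hq => rw [app_add_left, hp, hq, eval_add, add_smul]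
  | monomial n a =>
    induction g using Polynomial.induction_on' with
    | add p q hp hq => rw [app_add_right, hp, hq, add_comp, add_mul, smul_add]
    | monomial k b =>
      rw [← C_mul_X_pow_eq_monomial, ← C_mul_X_pow_eq_monomial, ← smul_eq_C_mul, ← smul_eq_C_mul,
        app_smul_left, app_smul_right, key]
      simp only [smul_eq_C_mul, eval_mul, eval_C, eval_pow, eval_X, mul_comp, C_comp,
        X_pow_comp, map_mul, map_pow]
      ring

open Polynomial in
/-- The product of the generator with itself in a transposed Poisson conformal structure on the
Virasoro Lie conformal algebra is a scalar multiple of the generator. -/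
lemma exists_app_one_one_eq
    (D : Module.End ℂ ℂ[X]) (hD : ∀ f, D f = X * f)
    (br : ℂ[X] →ₗ[ℂ] ℂ[X] →ₗ[ℂ] (ℕ →₀ ℂ[X]))
    (hbr : ∀ (f g : ℂ[X]) (l : ℂ),
      app br (sc l) f g = f.eval (-l) • (g.comp (X + C l) * (X + C (2 * l))))
    (m : ℂ[X] →ₗ[ℂ] ℂ[X] →ₗ[ℂ] (ℕ →₀ ℂ[X])) (h : IsTPCA D m br) :
    ∃ c : ℂ, ∀ l : ℂ, app m (sc l) 1 1 = C c := by
  set p : ℂ → ℂ[X] := fun l => app m (sc l) 1 1 with hp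
  have hleib : ∀ l u x : ℂ, 2 * ((x + l + 2 * u) * (p l).eval x)
      = (p l).eval (-(l + u)) * (x + 2 * (l + u)) + (p l).eval (x + u) * (x + 2 * u) := by
    intro l u x
    have := congrArg (eval x) (h.tLeibniz 1 1 1 l u)
    rw [hbr, hbr, hbr, h.commAssoc.app_eq D hD] at this
    simp only [hp, smul_eq_C_mul, eval_mul, eval_add, eval_C, eval_X, eval_one, one_comp, eval_comp]
      at this ⊢
    linear_combination this
  have hcomm : ∀ l x : ℂ, (p l).eval x = (p (-(x + l))).eval x := by
    intro l x
    rw [← eval_app_neg_add D hD, ← h.commAssoc.comm]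
  have hconst : ∀ l x : ℂ, l ≠ 0 → (p l).eval x = (p l).eval (-2 * l) := by
    intro l x hl
    refine eval_eq_of_halving _ _ (fun t => ?_) x
    have := hleib l (-(-2 * l + t) / 2) (-2 * l + t)
    have h1 : -(l + -(-2 * l + t) / 2) = -2 * l + t / 2 := by ring
    rw [h1] at this
    apply mul_left_cancel₀ (mul_ne_zero two_ne_zero hl)
    linear_combination this
  have hne : ∀ l x : ℂ, l ≠ 0 → (p l).eval x = (p 1).eval 0 := by
    intro l x hl
    rw [hconst l x hl, ← hconst l (-l - 1) hl, hcomm]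
    rw [show -(-l - 1 + l) = (1 : ℂ) by ring, hconst 1 _ one_ne_zero, ← hconst 1 0 one_ne_zero]
  refine ⟨(p 1).eval 0, fun l => ?_⟩
  refine Polynomial.eq_of_infinite_eval_eq _ _ (Set.Infinite.mono (s := {0}ᶜ) ?_
    (Set.finite_singleton _).infinite_compl)
  intro x hx
  simp only [Set.mem_ofPred_eq, eval_C]
  by_cases hl : l = 0
  · subst hl
    exact (hcomm 0 x).trans (hne _ x (by simpa using hx))
  · exact hne l x hl

open Polynomial in
/-- On the Virasoro Lie conformal algebra
`Vir = ℂ[∂]L` (modelled as `Polynomial ℂ`, the generator `L` being `1`, with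
`∂` acting as multiplication by `X` and bracket
`[f(∂)L_λ g(∂)L] = f(-λ)g(∂+λ)(∂+2λ)L`), a `ℂ`-bilinear `λ`-product `∘_λ`
makes `(Vir, ∘_λ, [·_λ·])` a transposed Poisson conformal algebra if and only
if there is a constant `c ∈ ℂ` with `L∘_λL = cL`, the product being extended
by conformal sesquilinearity : `f(∂)L ∘_λ g(∂)L = c · f(-λ)g(∂+λ)L`. -/
theorem virasoro_tpca_structures
    (D : Module.End ℂ (Polynomial ℂ))
    (hD : ∀ f : Polynomial ℂ, D f = Polynomial.X * f)
    (br : Polynomial ℂ →ₗ[ℂ] Polynomial ℂ →ₗ[ℂ] (ℕ →₀ Polynomial ℂ))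
    (hbr : ∀ (f g : Polynomial ℂ) (l : ℂ),
      app br (sc l) f g
        = f.eval (-l) • (g.comp (X + C l) * (X + C (2 * l))))
    (m : Polynomial ℂ →ₗ[ℂ] Polynomial ℂ →ₗ[ℂ] (ℕ →₀ Polynomial ℂ)) :
    IsTPCA D m br ↔
      ∃ c : ℂ, ∀ (f g : Polynomial ℂ) (l : ℂ),
        app m (sc l) f g = c • (f.eval (-l) • g.comp (X + C l)) := by
  constructor
  · intro h
    obtain ⟨c, hc⟩ := exists_app_one_one_eq D hD br hbr m h
    refine ⟨c, fun f g l => ?_⟩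
    rw [h.commAssoc.app_eq D hD, hc]
    simp only [smul_eq_C_mul]
    ring
  · rintro ⟨c, hm⟩
    refine ⟨⟨⟨?_, ?_⟩, ?_, ?_⟩, ⟨?_, ?_, ?_⟩, ?_⟩
    · intro x y l
      simp [hm, hD, smul_smul]
      ring_nf
    · intro x y l
      simp only [hm, hD, smul_eq_C_mul, mul_comp, X_comp]
      ring
    · intro x y z l u
      apply Polynomial.funext
      intro t
      simp only [hm, eval_smul, eval_comp, eval_add, eval_X, eval_C, smul_eq_mul, smul_comp]
      ring_nf
    · intro x y l
      apply Polynomial.funext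
      intro t
      rw [eval_app_neg_add D hD]
      simp only [hm, eval_smul, eval_comp, eval_add, eval_X, eval_C, smul_eq_mul]
      ring_nf
    · intro x y l
      simp [hbr, hD, smul_smul]
    · intro x y l
      apply Polynomial.funext
      intro t
      rw [add_comm, eval_neg, eval_app_neg_add D hD]
      simp [hbr]
      ring_nf
    · intro x y z l u
      apply Polynomial.funext
      intro t
      simp [hbr]
      ring_nf
    · intro x y z l u
      apply Polynomial.funext
      intro t
      simp [hm, hbr]
      ring_nf

end ConfFormal
end
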